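/- The equation x² + 29·y² = 3·z³ has no primitive integer solutions, i.e. there are no x, y, z ∈ ℤ with gcd(x, y, z) = 1 and x² + 29y² = 3z³. -/

import Mathlib

/-- A positive definite form `aX² + 2bXY + cY²` with `ac - b² = 29` represents an integer
between `1` and `6`. -/
theorem exists_small_value (a b c : ℤ) (ha : 0 < a) (h : a * c = b ^ 2 + 29) :
    ∃ X Y : ℤ, 0 < a * X ^ 2 + 2 * b * X * Y + c * Y ^ 2 ∧
      a * X ^ 2 + 2 * b * X * Y + c * Y ^ 2 ≤ 6 := by
  induction hn : a.toNat using Nat.strong_induction_on generalizing a b c with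
  | _ n ih =>
    by_cases ha6 : a ≤ 6
    · exact ⟨1, 0, by linarith, by linarith⟩
    · obtain ⟨q, hq₁, hq₂⟩ : ∃ q : ℤ, -a ≤ 2 * (b - a * q) ∧ 2 * (b - a * q) ≤ a := by
        refine ⟨(2 * b + a) / (2 * a), ?_, ?_⟩
        · have := Int.mul_ediv_add_emod (2 * b + a) (2 * a)
          have := Int.emod_nonneg (2 * b + a) (by omega : 2 * a ≠ 0)
          linarith
        · have := Int.mul_ediv_add_emod (2 * b + a) (2 * a)
          have := Int.emod_lt_of_pos (2 * b + a) (by omega : 0 < 2 * a)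
          linarith
      have hc : (c - 2 * b * q + a * q ^ 2) * a = (b - a * q) ^ 2 + 29 := by
        linear_combination h
      have hpos : 0 < c - 2 * b * q + a * q ^ 2 := by
        refine pos_of_mul_pos_left (b := a) ?_ ha.le
        rw [hc]; positivity
      have hlt : c - 2 * b * q + a * q ^ 2 < a := by
        refine lt_of_mul_lt_mul_right (a := a) ?_ ha.le
        rw [hc]
        nlinarith
      obtain ⟨X, Y, h₁, h₂⟩ := ih _ (by omega) _ _ _ hpos hc rfl
      have e : a * (Y - q * X) ^ 2 + 2 * b * (Y - q * X) * X + c * X ^ 2 =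
          (c - 2 * b * q + a * q ^ 2) * X ^ 2 + 2 * (b - a * q) * X * Y + a * Y ^ 2 := by ring
      exact ⟨Y - q * X, X, by rwa [e], by rwa [e]⟩

/-- The only representations `u² + 29v² = 3m³` with `1 ≤ m ≤ 6` are `(±9)² = 3 * 3³`. -/
theorem eq_three_of_sq_add_eq {u v m : ℤ} (hm : 0 < m) (hm6 : m ≤ 6)
    (h : u ^ 2 + 29 * v ^ 2 = 3 * m ^ 3) : m = 3 ∧ v = 0 ∧ u ^ 2 = 81 := by
  have hv : v ^ 2 ≤ 22 := by interval_cases m <;> nlinarith [sq_nonneg u]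
  have hu : u ^ 2 ≤ 648 := by interval_cases m <;> nlinarith [sq_nonneg v]
  have hv' : v.natAbs < 5 := by
    zify; exact abs_lt_of_sq_lt_sq (by linarith) (by norm_num)
  have hu' : u.natAbs < 26 := by
    zify; exact abs_lt_of_sq_lt_sq (by linarith) (by norm_num)
  have key : ∀ m : ℕ, m < 7 → ∀ v : ℕ, v < 5 → ∀ u : ℕ, u < 26 → 0 < m →
      u ^ 2 + 29 * v ^ 2 = 3 * m ^ 3 → m = 3 ∧ v = 0 ∧ u = 9 := by
    intro m hm v hv
    interval_cases m <;> interval_cases v <;> decide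
  lift m to ℕ using hm.le
  obtain ⟨hm3, hv0, hu9⟩ := key m (by omega) _ hv' _ hu' (by omega)
    (by zify; simpa using h)
  refine ⟨by omega, by omega, ?_⟩
  rw [← Int.natAbs_sq, hu9]
  norm_num

/-- The equation `x² + 29y² = 3z³` has no primitive integer solutions. -/
theorem stmt_15 :
    ¬ ∃ x y z : ℤ, Int.gcd (Int.gcd x y) z = 1 ∧
      x ^ 2 + 29 * y ^ 2 = 3 * z ^ 3 := by
  rintro ⟨x, y, z, hg, h⟩
  have no_prime : ∀ p : ℤ, Prime p → p ∣ x → p ∣ y → p ∣ z → False := by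
    intro p hp hx hy hz
    have := Int.dvd_coe_gcd (Int.dvd_coe_gcd hx hy) hz
    rw [hg] at this
    exact hp.not_isUnit (isUnit_of_dvd_one (by exact_mod_cast this))
  have hyz : IsCoprime y z := by
    refine isCoprime_of_prime_dvd ?_ ?_
    · rintro ⟨rfl, rfl⟩
      have : x = 0 := by simpa using h
      simp [this] at hg
    · intro p hp hy hz
      refine no_prime p hp (hp.dvd_of_dvd_pow (n := 2) ?_) hy hz
      rw [show x ^ 2 = 3 * z ^ 3 - 29 * y ^ 2 by linarith]
      exact dvd_sub ((dvd_pow hz (by norm_num)).mul_left _) ((dvd_pow hy (by norm_num)).mul_left _)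
  have hz : 0 < z := by
    have hz0 : 0 ≤ z := by
      by_contra! hneg
      nlinarith [sq_nonneg x, sq_nonneg y, Odd.pow_neg (n := 3) (by decide) hneg]
    rcases hz0.lt_or_eq with hz | rfl
    · exact hz
    · have hx : x = 0 := by nlinarith [sq_nonneg x, sq_nonneg y]
      have hy : y = 0 := by nlinarith [sq_nonneg x, sq_nonneg y]
      simp [hx, hy] at hg
  -- `k` is a square root of `-29` modulo `z³` with `x ≡ ky`.
  obtain ⟨k, l, w, hx, hk⟩ : ∃ k l w : ℤ, x = k * y + z ^ 3 * l ∧ k ^ 2 + 29 = z ^ 3 * w := by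
    obtain ⟨p, q, hpq⟩ := hyz.pow_right (n := 3)
    refine ⟨p * x, x * q, 3 * p ^ 2 + 29 * q * (1 + p * y), ?_, ?_⟩
    · linear_combination -x * hpq
    · linear_combination p ^ 2 * h - 29 * (1 + p * y) * hpq
  obtain ⟨X, t, hm, hm6⟩ := exists_small_value z k (z ^ 2 * w) hz (by linear_combination -hk)
  obtain ⟨m, hmdef⟩ : ∃ m, m = z * X ^ 2 + 2 * k * X * t + z ^ 2 * w * t ^ 2 := ⟨_, rfl⟩
  rw [← hmdef] at hm hm6
  obtain ⟨s, hs⟩ : ∃ s, s = k * t + z * X := ⟨_, rfl⟩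
  have hst : s ^ 2 + 29 * t ^ 2 = z * m := by
    rw [hs, hmdef]; linear_combination t ^ 2 * hk
  -- `S + T√-29` is the cube of `s + t√-29`.
  obtain ⟨S, hS⟩ : ∃ S, S = s ^ 3 - 87 * s * t ^ 2 := ⟨_, rfl⟩
  obtain ⟨T, hT⟩ : ∃ T, T = 3 * s ^ 2 * t - 29 * t ^ 3 := ⟨_, rfl⟩
  have hST : S ^ 2 + 29 * T ^ 2 = (z * m) ^ 3 := by
    rw [← hst, hS, hT]; ring
  obtain ⟨R, hR⟩ : ∃ R, S = k * T + z ^ 3 * R := by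
    refine ⟨X ^ 3 - 3 * t ^ 2 * w * z * X - 2 * k * w * t ^ 3, ?_⟩
    rw [hS, hT, hs]
    linear_combination (-3 * t ^ 2 * z * X - 2 * k * t ^ 3) * hk
  obtain ⟨u, hu⟩ : ∃ u, x * S + 29 * y * T = z ^ 3 * u := by
    refine ⟨y * T * w + k * y * R + l * S, ?_⟩
    rw [hx]
    linear_combination k * y * hR + y * T * hk
  obtain ⟨v, hv⟩ : ∃ v, y * S - x * T = z ^ 3 * v := by
    refine ⟨y * R - l * T, ?_⟩
    rw [hx]
    linear_combination y * hR
  have hz3 : z ^ 3 ≠ 0 := by positivity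
  have huv : u ^ 2 + 29 * v ^ 2 = 3 * m ^ 3 := by
    refine mul_left_cancel₀ (pow_ne_zero 2 hz3) ?_
    calc (z ^ 3) ^ 2 * (u ^ 2 + 29 * v ^ 2) = (z ^ 3 * u) ^ 2 + 29 * (z ^ 3 * v) ^ 2 := by ring
      _ = (x ^ 2 + 29 * y ^ 2) * (S ^ 2 + 29 * T ^ 2) := by rw [← hu, ← hv]; ring
      _ = _ := by rw [h, hST]; ring
  obtain ⟨rfl, rfl, hu81⟩ := eq_three_of_sq_add_eq hm hm6 huv
  have huS : u * S = 27 * x := by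
    refine mul_left_cancel₀ hz3 ?_
    linear_combination -S * hu + 29 * T * hv + x * hST
  have huT : u * T = 27 * y := by
    refine mul_left_cancel₀ hz3 ?_
    linear_combination -T * hu - S * hv + y * hST
  have hu9 : u = 9 ∨ u = -9 := sq_eq_sq_iff_eq_or_eq_neg.mp (by linarith)
  have h3 : Prime (3 : ℤ) := Int.prime_three
  have ht : (3 : ℤ) ∣ t := by
    refine h3.dvd_of_dvd_pow (n := 3) ?_
    have : (3 : ℤ) ∣ T := by rcases hu9 with rfl | rfl <;> omega
    have : (3 : ℤ) ∣ 3 * (s ^ 2 * t) - 29 * t ^ 3 := by rwa [← mul_assoc, ← hT]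
    omega
  have hs3 : (3 : ℤ) ∣ s := by
    refine h3.dvd_of_dvd_pow (n := 3) ?_
    have : (3 : ℤ) ∣ S := by rcases hu9 with rfl | rfl <;> omega
    have : (3 : ℤ) ∣ s ^ 3 - 87 * (s * t ^ 2) := by rwa [← mul_assoc, ← hS]
    omega
  have hz3 : (3 : ℤ) ∣ z := by
    obtain ⟨t', rfl⟩ := ht
    obtain ⟨s', rfl⟩ := hs3
    exact ⟨s' ^ 2 + 29 * t' ^ 2, by linarith⟩
  obtain ⟨t', rfl⟩ := ht
  obtain ⟨s', rfl⟩ := hs3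
  have hS' : S = 27 * (s' ^ 3 - 87 * s' * t' ^ 2) := by rw [hS]; ring
  have hT' : T = 27 * (3 * s' ^ 2 * t' - 29 * t' ^ 3) := by rw [hT]; ring
  refine no_prime 3 h3 ?_ ?_ hz3
  · rcases hu9 with rfl | rfl <;> omega
  · rcases hu9 with rfl | rfl <;> omega
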